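/- arXiv:1207.5195 — 5 statements merged into one kernel-verified Lean document; each statement's English description precedes it below -/
import Mathlib

section
/- For each n ∈ ℕ let F_n be a finite family of l_n pairwise disjoint bounded closed intervals on ℝ, each colored black or red, with l_n ≤ l for a fixed l, such that: the sum of the lengths of the l_n − 1 gaps between consecutive intervals of F_n is at most M (a constant independent of n); the leftmost interval of F_n is black and the rightmost is red; and the lengths of the leftmost interval and of the rightmost interval tend to +∞ as n → ∞. Then there exist a subsequence (n_k), a constant M₁ > 0, and for each k a black interval [a₁ᵏ, a₂ᵏ] ∈ F_{n_k} and a red interval [c₁ᵏ, c₂ᵏ] ∈ F_{n_k} such that a₂ᵏ − a₁ᵏ → +∞, c₂ᵏ − c₁ᵏ → +∞, and 0 < c₁ᵏ − a₂ᵏ ≤ M₁ for all k. -/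
open Filter

/-- Along a common subsequence, each of finitely many real sequences either tends to `+∞` or is
bounded above. -/
lemma exists_subseq_tendsto_atTop_or_bddAbove (f : ℕ → ℕ → ℝ) (l : ℕ) :
    ∃ σ : ℕ → ℕ, StrictMono σ ∧ ∀ i < l,
      Tendsto (f i ∘ σ) atTop atTop ∨ BddAbove (Set.range (f i ∘ σ)) := by
  induction l with
  | zero => exact ⟨id, strictMono_id, by simp⟩
  | succ l ih =>
    obtain ⟨σ, hσ, h⟩ := ih
    by_cases hb : BddAbove (Set.range (f l ∘ σ))
    · refine ⟨σ, hσ, fun i hi => ?_⟩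
      rcases Nat.lt_succ_iff_lt_or_eq.mp hi with hi | rfl
      exacts [h i hi, Or.inr hb]
    · obtain ⟨τ, hτ, hlim⟩ : ∃ τ : ℕ → ℕ, StrictMono τ ∧ Tendsto ((f l ∘ σ) ∘ τ) atTop atTop := by
        have hunb : ∀ k : ℕ, ∃ᶠ n in atTop, (k : ℝ) ≤ (f l ∘ σ) n := by
          intro k hk
          apply hb
          rw [← Nat.cofinite_eq_atTop] at hk
          have hbdd : IsBoundedUnder (· ≤ ·) cofinite (f l ∘ σ) :=
            ⟨k, eventually_map.mpr (hk.mono fun n hn => (not_le.mp hn).le)⟩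
          exact hbdd.bddAbove_range_of_cofinite
        obtain ⟨τ, hτ, hge⟩ := extraction_forall_of_frequently hunb
        exact ⟨τ, hτ, tendsto_atTop_mono hge tendsto_natCast_atTop_atTop⟩
      refine ⟨σ ∘ τ, hσ.comp hτ, fun i hi => ?_⟩
      rcases Nat.lt_succ_iff_lt_or_eq.mp hi with hi | rfl
      · exact (h i hi).imp (fun ht => ht.comp hτ.tendsto_atTop)
          fun hbd => hbd.mono (Set.range_comp_subset_range τ (f i ∘ σ))
      · exact Or.inl hlim

/-- The distance between two intervals is the sum of the gaps and of the lengths of the intervals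
between them. -/
lemma dist_eq_sum_gaps_add_sum_lengths (J : ℕ → ℝ × ℝ) {a c : ℕ} (hac : a + 1 ≤ c) :
    (J c).1 - (J a).2 = ∑ i ∈ Finset.Ico a c, ((J (i + 1)).1 - (J i).2) +
      ∑ i ∈ Finset.Ico (a + 1) c, ((J i).2 - (J i).1) := by
  induction c, hac using Nat.le_induction with
  | base => simp
  | succ m hm ih =>
    rw [Finset.sum_Ico_succ_top (by omega), Finset.sum_Ico_succ_top hm]
    linarith

/-- In a finite ordered family whose first interval is black and last one is red, both in `S`, and
whose intervals outside `S` have length at most `B`, some black interval in `S` is followed by a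
red one in `S` at a distance bounded in terms of the total gap length and `B`. -/
lemma exists_black_red_of_bounded_off (S : Set ℕ) {N : ℕ} {M B : ℝ} (hN : 0 < N) (hB : 0 ≤ B)
    (J : ℕ → ℝ × ℝ) (col : ℕ → Bool)
    (horder : ∀ i j, i < j → j < N → (J i).2 < (J j).1)
    (hgaps : ∑ i ∈ Finset.range (N - 1), ((J (i + 1)).1 - (J i).2) ≤ M)
    (hleft : col 0 = false) (hright : col (N - 1) = true)
    (hS0 : 0 ∈ S) (hSN : N - 1 ∈ S) (hSB : ∀ i < N, i ∉ S → (J i).2 - (J i).1 ≤ B) :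
    ∃ a c, a < N ∧ c < N ∧ a ∈ S ∧ c ∈ S ∧ col a = false ∧ col c = true ∧
      0 < (J c).1 - (J a).2 ∧ (J c).1 - (J a).2 ≤ M + N * B := by
  classical
  have hex : ∃ c, c ∈ S ∧ col c = true := ⟨N - 1, hSN, hright⟩
  obtain ⟨hcS, hcol⟩ := Nat.find_spec hex
  have hmin := fun m (hm : m < Nat.find hex) => Nat.find_min hex hm
  have hcN : Nat.find hex ≤ N - 1 := Nat.find_min' hex ⟨hSN, hright⟩
  set c := Nat.find hex
  have hc0 : 0 < c := Nat.pos_of_ne_zero fun h => by simp [h, hleft] at hcol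
  set a := Nat.findGreatest (· ∈ S) (c - 1)
  have haS : a ∈ S := Nat.findGreatest_spec (P := (· ∈ S)) (Nat.zero_le (c - 1)) hS0
  have hac : a < c := by
    have : a ≤ c - 1 := Nat.findGreatest_le (c - 1)
    omega
  have hbetween : ∀ i, a < i → i < c → i ∉ S := fun i hai hic =>
    Nat.findGreatest_is_greatest hai (by omega)
  refine ⟨a, c, by omega, by omega, haS, hcS, ?_, hcol,
    sub_pos.mpr (horder a c hac (by omega)), ?_⟩
  · simpa [haS] using hmin a hac
  · rw [dist_eq_sum_gaps_add_sum_lengths J hac]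
    refine add_le_add (le_trans ?_ hgaps) ?_
    · refine Finset.sum_le_sum_of_subset_of_nonneg (fun i hi => ?_) fun i hi _ => ?_
      · simp only [Finset.mem_Ico, Finset.mem_range] at hi ⊢
        omega
      · rw [Finset.mem_range] at hi
        exact (sub_pos.mpr (horder i (i + 1) (by omega) (by omega))).le
    · calc ∑ i ∈ Finset.Ico (a + 1) c, ((J i).2 - (J i).1)
          ≤ (Finset.Ico (a + 1) c).card • B := Finset.sum_le_card_nsmul _ _ _ fun i hi => by
            rw [Finset.mem_Ico] at hi
            exact hSB i (by omega) (hbetween i (by omega) hi.2)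
        _ ≤ N * B := by
          rw [nsmul_eq_mul, Nat.card_Ico]
          gcongr
          omega

/-- interval selection: for each `n`, `F n` is a family of `ln n ≤ l`
pairwise disjoint bounded closed intervals `[(I n i).1, (I n i).2]`, `i < ln n`, ordered
from left to right, each colored black (`false`) or red (`true`); the total length of the
gaps between consecutive intervals is at most `M`; the leftmost interval is black, the
rightmost is red, and their lengths tend to `+∞`.  Then along a subsequence one can pick
a black interval and a red interval whose lengths tend to `+∞`, the red one lying to the
right of the black one at a positive distance bounded by a constant `M₁`. -/
theorem statement7 (l : ℕ) (M : ℝ) (ln : ℕ → ℕ) (hpos : ∀ n, 0 < ln n)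
    (hl : ∀ n, ln n ≤ l)
    (I : ℕ → ℕ → ℝ × ℝ) (color : ℕ → ℕ → Bool)
    (hIne : ∀ n i, i < ln n → (I n i).1 ≤ (I n i).2)
    (horder : ∀ n i j, i < j → j < ln n → (I n i).2 < (I n j).1)
    (hgaps : ∀ n, ∑ i ∈ Finset.range (ln n - 1), ((I n (i + 1)).1 - (I n i).2) ≤ M)
    (hleft : ∀ n, color n 0 = false)
    (hright : ∀ n, color n (ln n - 1) = true)
    (hlenL : Tendsto (fun n => (I n 0).2 - (I n 0).1) atTop atTop)
    (hlenR : Tendsto (fun n => (I n (ln n - 1)).2 - (I n (ln n - 1)).1) atTop atTop) :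
    ∃ σ : ℕ → ℕ, StrictMono σ ∧ ∃ M₁ : ℝ, 0 < M₁ ∧ ∃ A C : ℕ → ℕ,
      (∀ k, A k < ln (σ k) ∧ C k < ln (σ k) ∧
        color (σ k) (A k) = false ∧ color (σ k) (C k) = true ∧
        0 < (I (σ k) (C k)).1 - (I (σ k) (A k)).2 ∧
        (I (σ k) (C k)).1 - (I (σ k) (A k)).2 ≤ M₁) ∧
      Tendsto (fun k => (I (σ k) (A k)).2 - (I (σ k) (A k)).1) atTop atTop ∧
      Tendsto (fun k => (I (σ k) (C k)).2 - (I (σ k) (C k)).1) atTop atTop := by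
  obtain ⟨σ, hσ, hdich⟩ :=
    exists_subseq_tendsto_atTop_or_bddAbove (fun i n => (I n i).2 - (I n i).1) l
  let S : Set ℕ := {i | Tendsto (fun k => (I (σ k) i).2 - (I (σ k) i).1) atTop atTop}
  obtain ⟨B, hB, hSB⟩ : ∃ B : ℝ, 0 ≤ B ∧
      ∀ i < l, i ∉ S → ∀ k, (I (σ k) i).2 - (I (σ k) i).1 ≤ B := by
    have hbdd : ∀ i, ∃ b : ℝ, i < l → i ∉ S → ∀ k, (I (σ k) i).2 - (I (σ k) i).1 ≤ b := by
      intro i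
      by_cases hi : i < l ∧ i ∉ S
      · obtain ⟨b, hb⟩ := (hdich i hi.1).resolve_left hi.2
        exact ⟨b, fun _ _ k => hb ⟨k, rfl⟩⟩
      · exact ⟨0, fun h₁ h₂ => (hi ⟨h₁, h₂⟩).elim⟩
    choose b hb using hbdd
    refine ⟨∑ i ∈ Finset.range l, |b i|, by positivity, fun i hi hiS k => ?_⟩
    exact ((hb i hi hiS k).trans (le_abs_self _)).trans
      (Finset.single_le_sum (f := fun i => |b i|) (fun _ _ => abs_nonneg _)
        (Finset.mem_range.mpr hi))
  have hS0 : 0 ∈ S := hlenL.comp hσ.tendsto_atTop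
  obtain ⟨K, hK⟩ := eventually_atTop.mp
    ((hlenR.comp hσ.tendsto_atTop).eventually (eventually_gt_atTop B))
  have hlast : ∀ k, ln (σ (k + K)) - 1 ∈ S := by
    intro k
    by_contra hS
    have hlt : ln (σ (k + K)) - 1 < l := by
      have := hpos (σ (k + K))
      have := hl (σ (k + K))
      omega
    exact (hK (k + K) (by omega)).not_ge (hSB _ hlt hS (k + K))
  choose A C hA hC hAS hCS hcolA hcolC hdpos hd using fun k =>
    exists_black_red_of_bounded_off S (hpos (σ (k + K))) hB (I (σ (k + K))) (color (σ (k + K)))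
      (horder _) (hgaps _) (hleft _) (hright _) hS0 (hlast k)
      fun i hi hiS => hSB i (hi.trans_le (hl _)) hiS _
  have hshift : StrictMono fun k => k + K := fun _ _ h => Nat.add_lt_add_right h K
  have hlim : ∀ D : ℕ → ℕ, (∀ k, D k < ln (σ (k + K))) → (∀ k, D k ∈ S) →
      Tendsto (fun k => (I (σ (k + K)) (D k)).2 - (I (σ (k + K)) (D k)).1) atTop atTop := by
    intro D hD hDS
    refine tendsto_atTop.mpr fun T => ?_
    have hall : ∀ᶠ k in atTop, ∀ i ∈ Finset.range l, i ∈ S →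
        T ≤ (I (σ (k + K)) i).2 - (I (σ (k + K)) i).1 := by
      refine (Finset.eventually_all _).mpr fun i _ => ?_
      by_cases hi : i ∈ S
      · exact ((Tendsto.comp hi hshift.tendsto_atTop).eventually_ge_atTop T).mono fun k hk _ => hk
      · exact Eventually.of_forall fun k h => (hi h).elim
    filter_upwards [hall] with k hk
    exact hk _ (Finset.mem_range.mpr ((hD k).trans_le (hl _))) (hDS k)
  refine ⟨fun k => σ (k + K), hσ.comp hshift, |M| + l * B + 1, by positivity, A, C,
    fun k => ⟨hA k, hC k, hcolA k, hcolC k, hdpos k, ?_⟩, hlim A hA hAS, hlim C hC hCS⟩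
  have hlB : (ln (σ (k + K)) : ℝ) * B ≤ l * B := by
    gcongr
    exact hl _
  linarith [hd k, le_abs_self M]
end

section
/- For any 0 < s ≤ r and any point (y₁,z₁) ∈ ℝ², the integral I = ∫_{[−s,s]×[−r,r]} ((y−y₁)² + (z−z₁)²)^{−1/2} dy dz satisfies I < 10 s (1 + ln(r/s)). -/
open MeasureTheory

/-- Bathtub comparison: among sets of the same finite measure, the integral of `g` is largest on a
superlevel set of `g`. -/
lemma setLIntegral_le_of_level {α : Type*} [MeasurableSpace α] {μ : Measure α} {A B : Set α}
    (hA : MeasurableSet A) (hB : MeasurableSet B) (hAB : μ A = μ B) (hfin : μ A ≠ ⊤)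
    {g : α → ENNReal} {c : ENNReal} (hin : ∀ x ∈ B, c ≤ g x) (hout : ∀ x ∉ B, g x ≤ c) :
    ∫⁻ x in A, g x ∂μ ≤ ∫⁻ x in B, g x ∂μ := by
  have hdiff : μ (A \ B) = μ (B \ A) :=
    measure_sdiff_symm hA.nullMeasurableSet hB.nullMeasurableSet hAB
      (measure_ne_top_of_subset Set.inter_subset_left hfin)
  rw [← lintegral_inter_add_sdiff g A hB, ← lintegral_inter_add_sdiff g B hA, Set.inter_comm B A]
  gcongr 1
  calc ∫⁻ x in A \ B, g x ∂μ ≤ ∫⁻ _ in A \ B, c ∂μ :=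
        setLIntegral_mono' (hA.diff hB) fun x hx => hout x hx.2
    _ = ∫⁻ _ in B \ A, c ∂μ := by simp [hdiff]
    _ ≤ ∫⁻ x in B \ A, g x ∂μ := setLIntegral_mono' (hB.diff hA) fun x hx => hin x hx.1

lemma setLIntegral_Icc_abs_sub_le {φ : ℝ → ENNReal} (hφ : AntitoneOn φ (Set.Ici 0)) {s : ℝ}
    (hs : 0 ≤ s) (a : ℝ) :
    ∫⁻ x in Set.Icc (-s) s, φ |x - a| ≤ 2 * ∫⁻ x in Set.Ioc 0 s, φ x := by
  have hright : ∫⁻ x in Set.Ioc a (a + s), φ |x - a| = ∫⁻ x in Set.Ioc 0 s, φ x := by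
    have h := (measurePreserving_add_left volume a).setLIntegral_comp_preimage_emb
      (measurableEmbedding_addLeft a) (fun x => φ |x - a|) (Set.Ioc a (a + s))
    rw [← h]
    simp only [Set.preimage_const_add_Ioc, sub_self, add_sub_cancel_left]
    exact setLIntegral_congr_fun measurableSet_Ioc fun x hx => by simp only [abs_of_pos hx.1]
  have hleft : ∫⁻ x in Set.Ico (a - s) a, φ |x - a| = ∫⁻ x in Set.Ioc 0 s, φ x := by
    have h := (Measure.measurePreserving_sub_left volume a).setLIntegral_comp_preimage_emb
      (measurableEmbedding_subLeft a) (fun x => φ |x - a|) (Set.Ico (a - s) a)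
    rw [← h]
    simp only [Set.preimage_const_sub_Ico, sub_self, sub_sub_cancel, sub_sub_cancel_left, abs_neg]
    exact setLIntegral_congr_fun measurableSet_Ioc fun x hx => by simp only [abs_of_pos hx.1]
  calc ∫⁻ x in Set.Icc (-s) s, φ |x - a| ≤ ∫⁻ x in Set.Icc (a - s) (a + s), φ |x - a| := by
        refine setLIntegral_le_of_level (c := φ s) measurableSet_Icc measurableSet_Icc
          ?_ (by simp) ?_ ?_
        · simp only [Real.volume_Icc]
          ring_nf
        · intro x hx
          exact hφ (Set.mem_Ici.2 (abs_nonneg _)) hs (abs_le.2 ⟨by linarith [hx.1], by linarith [hx.2]⟩)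
        · intro x hx
          refine hφ hs (Set.mem_Ici.2 (abs_nonneg _)) (le_of_not_ge fun h => hx ?_)
          rw [abs_le] at h
          exact ⟨by linarith [h.1], by linarith [h.2]⟩
    _ = ∫⁻ x in Set.Ico (a - s) (a + s), φ |x - a| :=
        setLIntegral_congr Ico_ae_eq_Icc.symm
    _ = ∫⁻ x in Set.Ico (a - s) a ∪ Set.Ico a (a + s), φ |x - a| := by
        rw [Set.Ico_union_Ico_eq_Ico (by linarith) (by linarith)]
    _ ≤ (∫⁻ x in Set.Ico (a - s) a, φ |x - a|) + ∫⁻ x in Set.Ico a (a + s), φ |x - a| :=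
        lintegral_union_le _ _ _
    _ = 2 * ∫⁻ x in Set.Ioc 0 s, φ x := by
        rw [setLIntegral_congr (Ico_ae_eq_Ioc (a := a) (b := a + s)), hleft, hright, two_mul]

lemma setLIntegral_Ioc_inv_add {s z : ℝ} (hs : 0 ≤ s) (hz : 0 < z) :
    ∫⁻ y in Set.Ioc 0 s, (ENNReal.ofReal (y + z))⁻¹ =
      ENNReal.ofReal (Real.log (s + z) - Real.log z) := by
  have h0 : (0 : ℝ) ∉ Set.uIcc (0 + z) (s + z) := by
    rw [Set.uIcc_of_le (by linarith)]
    exact fun h => by linarith [h.1]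
  have hint : IntervalIntegrable (fun y => (y + z)⁻¹) volume 0 s := by
    refine ContinuousOn.intervalIntegrable_of_Icc hs ?_
    exact ContinuousOn.inv₀ (by fun_prop) fun x hx => by linarith [hx.1]
  have hval : ∫ y in (0 : ℝ)..s, (y + z)⁻¹ = Real.log (s + z) - Real.log z := by
    rw [intervalIntegral.integral_comp_add_right (fun y => y⁻¹), integral_inv h0, zero_add,
      Real.log_div (by linarith) hz.ne']
  rw [← hval, intervalIntegral.integral_of_le hs, ofReal_integral_eq_lintegral_ofReal
    ((intervalIntegrable_iff_integrableOn_Ioc_of_le hs).1 hint)]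
  · exact setLIntegral_congr_fun measurableSet_Ioc fun y hy =>
      (ENNReal.ofReal_inv_of_pos (by linarith [hy.1])).symm
  · exact (ae_restrict_mem measurableSet_Ioc).mono fun y hy =>
      inv_nonneg.2 (by linarith [hy.1])

lemma setLIntegral_Ioc_Ioc_inv_add {s r : ℝ} (hs : 0 ≤ s) (hr : 0 ≤ r) :
    ∫⁻ z in Set.Ioc 0 r, ∫⁻ y in Set.Ioc 0 s, (ENNReal.ofReal (y + z))⁻¹ =
      ENNReal.ofReal ((s + r) * Real.log (s + r) - s * Real.log s - r * Real.log r) := by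
  have hint₁ : IntervalIntegrable (fun z => Real.log (s + z)) volume 0 r := by
    have h : IntervalIntegrable Real.log volume (s + 0) (s + r) :=
      intervalIntegral.intervalIntegrable_log'
    simpa using h.comp_add_left s
  have hint₂ : IntervalIntegrable Real.log volume 0 r := intervalIntegral.intervalIntegrable_log'
  have hval : ∫ z in (0 : ℝ)..r, (Real.log (s + z) - Real.log z) =
      (s + r) * Real.log (s + r) - s * Real.log s - r * Real.log r := by
    rw [intervalIntegral.integral_sub hint₁ hint₂,
      intervalIntegral.integral_comp_add_left Real.log, integral_log, integral_log]
    simp only [add_zero, Real.log_zero]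
    ring
  rw [← hval, intervalIntegral.integral_of_le hr, ofReal_integral_eq_lintegral_ofReal
    ((intervalIntegrable_iff_integrableOn_Ioc_of_le hr).1 (hint₁.sub hint₂))]
  · exact setLIntegral_congr_fun measurableSet_Ioc fun z hz => setLIntegral_Ioc_inv_add hs hz.1
  · exact (ae_restrict_mem measurableSet_Ioc).mono fun z hz =>
      sub_nonneg.2 (Real.log_le_log hz.1 (by linarith))

lemma setLIntegral_rectangle_inv_le {s r : ℝ} (hs : 0 ≤ s) (hr : 0 ≤ r) (y₁ z₁ : ℝ) :
    ∫⁻ p in Set.Icc (-s) s ×ˢ Set.Icc (-r) r, (ENNReal.ofReal (|p.1 - y₁| + |p.2 - z₁|))⁻¹ ≤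
      4 * ENNReal.ofReal ((s + r) * Real.log (s + r) - s * Real.log s - r * Real.log r) := by
  have hanti : ∀ {a b : ℝ}, a ≤ b → (ENNReal.ofReal b)⁻¹ ≤ (ENNReal.ofReal a)⁻¹ :=
    fun h => ENNReal.inv_le_inv.2 (ENNReal.ofReal_le_ofReal h)
  have hmeas : Measurable fun p : ℝ × ℝ => (ENNReal.ofReal (|p.1 - y₁| + |p.2 - z₁|))⁻¹ := by
    fun_prop
  rw [Measure.volume_eq_prod, setLIntegral_prod_symm _ hmeas.aemeasurable]
  calc ∫⁻ z in Set.Icc (-r) r, ∫⁻ y in Set.Icc (-s) s,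
          (ENNReal.ofReal (|y - y₁| + |z - z₁|))⁻¹
      ≤ ∫⁻ z in Set.Icc (-r) r, 2 * ∫⁻ y in Set.Ioc 0 s, (ENNReal.ofReal (y + |z - z₁|))⁻¹ :=
        lintegral_mono fun z => setLIntegral_Icc_abs_sub_le
          (φ := fun y => (ENNReal.ofReal (y + |z - z₁|))⁻¹)
          (fun _ _ _ _ h => hanti (by gcongr)) hs y₁
    _ ≤ 2 * ∫⁻ z in Set.Ioc 0 r, 2 * ∫⁻ y in Set.Ioc 0 s, (ENNReal.ofReal (y + z))⁻¹ :=
        setLIntegral_Icc_abs_sub_le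
          (φ := fun z => 2 * ∫⁻ y in Set.Ioc 0 s, (ENNReal.ofReal (y + z))⁻¹)
          (fun _ _ _ _ h => mul_le_mul_right (lintegral_mono fun _ => hanti (by gcongr)) 2) hr z₁
    _ = 4 * ENNReal.ofReal ((s + r) * Real.log (s + r) - s * Real.log s - r * Real.log r) := by
        rw [lintegral_const_mul' _ _ (by simp), setLIntegral_Ioc_Ioc_inv_add hs hr, ← mul_assoc]
        norm_num

lemma ofReal_inv_sqrt_sq_add_sq_le (a b : ℝ) :
    ENNReal.ofReal (Real.sqrt (a ^ 2 + b ^ 2))⁻¹ ≤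
      ENNReal.ofReal √2 * (ENNReal.ofReal (|a| + |b|))⁻¹ := by
  rcases (add_nonneg (abs_nonneg a) (abs_nonneg b)).eq_or_lt with h | h
  · rw [← h]
    simp [ENNReal.mul_top]
  · rw [← ENNReal.ofReal_inv_of_pos h, ← ENNReal.ofReal_mul (by positivity)]
    refine ENNReal.ofReal_le_ofReal ?_
    have hpos : 0 < a ^ 2 + b ^ 2 := by
      nlinarith [sq_abs a, sq_abs b, sq_nonneg (|a| - |b|), mul_pos h h]
    rw [← div_eq_mul_inv, le_div_iff₀ h, inv_mul_le_iff₀ (Real.sqrt_pos.2 hpos),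
      ← Real.sqrt_mul hpos.le]
    refine Real.le_sqrt_of_sq_le ?_
    nlinarith [sq_abs a, sq_abs b, sq_nonneg (|a| - |b|)]

lemma add_mul_log_sub_le {s r : ℝ} (hs : 0 < s) (hsr : s ≤ r) :
    (s + r) * Real.log (s + r) - s * Real.log s - r * Real.log r ≤
      s * (1 + Real.log 2 + Real.log (r / s)) := by
  have hr : 0 < r := hs.trans_le hsr
  have h₁ : Real.log (s + r) ≤ Real.log 2 + Real.log r := by
    rw [← Real.log_mul two_ne_zero hr.ne']
    exact Real.log_le_log (by linarith) (by linarith)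
  have h₂ : r * (Real.log (s + r) - Real.log r) ≤ s := by
    rw [← Real.log_div (by linarith) hr.ne']
    calc r * Real.log ((s + r) / r) ≤ r * ((s + r) / r - 1) := by
          gcongr
          exact Real.log_le_sub_one_of_pos (by positivity)
      _ = s := by field_simp; ring
  rw [Real.log_div hr.ne' hs.ne']
  nlinarith [mul_le_mul_of_nonneg_left h₁ hs.le]

/-- for `0 < s ≤ r` and any `(y₁, z₁) ∈ ℝ²`,
`∫_{[−s,s]×[−r,r]} dy dz / √((y−y₁)² + (z−z₁)²) < 10 s (1 + ln(r/s))`. -/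
theorem statement10 (s r y₁ z₁ : ℝ) (hs : 0 < s) (hsr : s ≤ r) :
    ∫ p in Set.Icc (-s) s ×ˢ Set.Icc (-r) r,
        (Real.sqrt ((p.1 - y₁) ^ 2 + (p.2 - z₁) ^ 2))⁻¹ <
      10 * s * (1 + Real.log (r / s)) := by
  have hr : 0 < r := hs.trans_le hsr
  have hlog : 0 ≤ Real.log (r / s) := Real.log_nonneg ((one_le_div hs).2 hsr)
  set L := 1 + Real.log 2 + Real.log (r / s) with hL
  have hLpos : 0 < L := by linarith [Real.log_two_gt_d9]
  have hbound : ∫⁻ p in Set.Icc (-s) s ×ˢ Set.Icc (-r) r,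
      ENNReal.ofReal (Real.sqrt ((p.1 - y₁) ^ 2 + (p.2 - z₁) ^ 2))⁻¹ ≤
        ENNReal.ofReal (√2 * (4 * (s * L))) := by
    calc _ ≤ ∫⁻ p in Set.Icc (-s) s ×ˢ Set.Icc (-r) r,
          ENNReal.ofReal √2 * (ENNReal.ofReal (|p.1 - y₁| + |p.2 - z₁|))⁻¹ :=
          lintegral_mono fun p => ofReal_inv_sqrt_sq_add_sq_le _ _
      _ ≤ ENNReal.ofReal √2 * (4 * ENNReal.ofReal (s * L)) := by
          rw [lintegral_const_mul' _ _ (by simp)]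
          gcongr
          refine (setLIntegral_rectangle_inv_le hs.le hr.le y₁ z₁).trans ?_
          gcongr
          exact add_mul_log_sub_le hs hsr
      _ = ENNReal.ofReal (√2 * (4 * (s * L))) := by
          rw [ENNReal.ofReal_mul (Real.sqrt_nonneg 2), ENNReal.ofReal_mul (p := 4) (by norm_num),
            ENNReal.ofReal_ofNat]
  rw [integral_eq_lintegral_of_nonneg_ae (Filter.Eventually.of_forall fun p => by positivity)
    (by fun_prop)]
  refine (ENNReal.toReal_le_of_le_ofReal (by positivity) hbound).trans_lt ?_
  have hsqrt : √2 < 1.42 := by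
    rw [Real.sqrt_lt' (by norm_num)]
    norm_num
  have hsL : 0 < s * L := mul_pos hs hLpos
  calc √2 * (4 * (s * L)) < 1.42 * (4 * (s * L)) := by gcongr
    _ < 10 * s * (1 + Real.log (r / s)) := by
      rw [hL]
      nlinarith [mul_lt_mul_of_pos_left Real.log_two_lt_d9 hs, mul_nonneg hs.le hlog]
end

section
/- Let a < b be real numbers, α > 0, and let m = (m₁,m₂,m₃) : [a,b] → S² be absolutely continuous. Then ∫_a^b |m′(x)|² dx + α² ∫_a^b (m₂(x)² + m₃(x)²) dx ≥ 2 α | m₁(a) − m₁(b) |. -/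
open MeasureTheory

/-- `f` is absolutely continuous on `[a,b]` with a.e. derivative `f'`:
`f'` is integrable on `[a,b]` and `f(x) − f(a) = ∫_a^x f'` for all `x ∈ [a,b]`. -/
def ACOn (f f' : ℝ → ℝ) (a b : ℝ) : Prop :=
  IntervalIntegrable f' volume a b ∧
  ∀ x ∈ Set.Icc a b, f x - f a = ∫ t in a..x, f' t

theorem ACOn.continuousOn {f f' : ℝ → ℝ} {a b : ℝ} (hab : a ≤ b) (h : ACOn f f' a b) :
    ContinuousOn f (Set.Icc a b) := by
  have hc := intervalIntegral.continuousOn_primitive_interval' h.1 Set.left_mem_uIcc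
  rw [Set.uIcc_of_le hab] at hc
  refine (hc.const_add (f a)).congr fun x hx => ?_
  linarith [h.2 x hx]

theorem ACOn.ae_hasDerivAt {f f' : ℝ → ℝ} {a b : ℝ} (hab : a ≤ b) (h : ACOn f f' a b) :
    ∀ᵐ x, x ∈ Set.Ioo a b → HasDerivAt f (f' x) x := by
  filter_upwards [h.1.ae_hasDerivAt_integral] with x hx hxab
  rw [Set.uIcc_of_le hab] at hx
  have hd := (hx (Set.Ioo_subset_Icc_self hxab) a (Set.left_mem_Icc.2 hab)).const_add (f a)
  refine hd.congr_of_eventuallyEq ?_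
  filter_upwards [Ioo_mem_nhds hxab.1 hxab.2] with y hy
  linarith [h.2 y (Set.Ioo_subset_Icc_self hy)]

theorem ACOn.ofReal_abs_sub_le_lintegral {f f' : ℝ → ℝ} {a b : ℝ} (hab : a ≤ b)
    (h : ACOn f f' a b) :
    ENNReal.ofReal |f a - f b| ≤ ∫⁻ x in Set.Ioo a b, ENNReal.ofReal |f' x| := by
  rw [abs_sub_comm, h.2 b (Set.right_mem_Icc.2 hab), intervalIntegral.integral_of_le hab,
    integral_Ioc_eq_integral_Ioo]
  simpa only [Real.enorm_eq_ofReal_abs] using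
    enorm_integral_le_lintegral_enorm (μ := volume.restrict (Set.Ioo a b)) f'

/-- Pointwise bound: a tangent vector `d` to the sphere at `m` satisfies
`2 α |d₁| ≤ |d|² + α² (m₂² + m₃²)`. -/
theorem two_mul_abs_le_of_tangent {α m₁ m₂ m₃ d₁ d₂ d₃ : ℝ}
    (hm : m₁ ^ 2 + m₂ ^ 2 + m₃ ^ 2 = 1) (hd : m₁ * d₁ + m₂ * d₂ + m₃ * d₃ = 0) :
    2 * α * |d₁| ≤ d₁ ^ 2 + d₂ ^ 2 + d₃ ^ 2 + α ^ 2 * (m₂ ^ 2 + m₃ ^ 2) := by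
  have key : (m₂ ^ 2 + m₃ ^ 2) * (d₁ ^ 2 + d₂ ^ 2 + d₃ ^ 2) - d₁ ^ 2
      = (m₂ * d₃ - m₃ * d₂) ^ 2 := by
    linear_combination d₁ ^ 2 * hm - (m₁ * d₁ - m₂ * d₂ - m₃ * d₃) * hd
  have hsq : d₁ ^ 2 ≤ (m₂ ^ 2 + m₃ ^ 2) * (d₁ ^ 2 + d₂ ^ 2 + d₃ ^ 2) := by
    linarith [sq_nonneg (m₂ * d₃ - m₃ * d₂)]
  refine abs_le_of_sq_le_sq' ?_ (by positivity) |>.2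
  rw [mul_pow, sq_abs]
  nlinarith [mul_le_mul_of_nonneg_left hsq (sq_nonneg (2 * α)),
    sq_nonneg (d₁ ^ 2 + d₂ ^ 2 + d₃ ^ 2 - α ^ 2 * (m₂ ^ 2 + m₃ ^ 2))]

theorem HasDerivAt.inner_eq_zero_of_sphere {m₁ m₂ m₃ : ℝ → ℝ} {d₁ d₂ d₃ x : ℝ}
    (h₁ : HasDerivAt m₁ d₁ x) (h₂ : HasDerivAt m₂ d₂ x) (h₃ : HasDerivAt m₃ d₃ x)
    (hm : ∀ᶠ y in nhds x, m₁ y ^ 2 + m₂ y ^ 2 + m₃ y ^ 2 = 1) :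
    m₁ x * d₁ + m₂ x * d₂ + m₃ x * d₃ = 0 := by
  have hsum := ((h₁.fun_pow 2).fun_add (h₂.fun_pow 2)).fun_add (h₃.fun_pow 2)
  have hzero := (hasDerivAt_const x (1 : ℝ)).congr_of_eventuallyEq hm
  have := hsum.unique hzero
  norm_num at this
  linarith

/-- for an absolutely continuous `m = (m₁,m₂,m₃) : [a,b] → S²` and `α > 0`,
`∫_a^b |m′|² + α² ∫_a^b (m₂² + m₃²) ≥ 2 α |m₁(a) − m₁(b)|` (the left-hand side being
`+∞` if `|m′|²` is not integrable, whence the `ℝ≥0∞`-valued formulation). -/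
theorem statement12 (a b α : ℝ) (hab : a < b) (hα : 0 < α)
    (m₁ m₂ m₃ d₁ d₂ d₃ : ℝ → ℝ)
    (h₁ : ACOn m₁ d₁ a b) (h₂ : ACOn m₂ d₂ a b) (h₃ : ACOn m₃ d₃ a b)
    (hsphere : ∀ x ∈ Set.Icc a b, m₁ x ^ 2 + m₂ x ^ 2 + m₃ x ^ 2 = 1) :
    ENNReal.ofReal (2 * α * |m₁ a - m₁ b|) ≤
      (∫⁻ x in Set.Ioo a b, ENNReal.ofReal (d₁ x ^ 2 + d₂ x ^ 2 + d₃ x ^ 2)) +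
        ENNReal.ofReal (α ^ 2) *
          ∫⁻ x in Set.Ioo a b, ENNReal.ofReal (m₂ x ^ 2 + m₃ x ^ 2) := by
  have hle := hab.le
  have hmeas : AEMeasurable (fun x => ENNReal.ofReal (m₂ x ^ 2 + m₃ x ^ 2))
      (volume.restrict (Set.Ioo a b)) := by
    have hc : ContinuousOn (fun x => m₂ x ^ 2 + m₃ x ^ 2) (Set.Ioo a b) :=
      (((h₂.continuousOn hle).pow 2).add ((h₃.continuousOn hle).pow 2)).mono
        Set.Ioo_subset_Icc_self
    exact (hc.aemeasurable measurableSet_Ioo).ennreal_ofReal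
  calc ENNReal.ofReal (2 * α * |m₁ a - m₁ b|)
      = ENNReal.ofReal (2 * α) * ENNReal.ofReal |m₁ a - m₁ b| :=
        ENNReal.ofReal_mul (by positivity)
    _ ≤ ENNReal.ofReal (2 * α) * ∫⁻ x in Set.Ioo a b, ENNReal.ofReal |d₁ x| := by
        gcongr
        exact h₁.ofReal_abs_sub_le_lintegral hle
    _ = ∫⁻ x in Set.Ioo a b, ENNReal.ofReal (2 * α) * ENNReal.ofReal |d₁ x| :=
        (lintegral_const_mul' _ _ ENNReal.ofReal_ne_top).symm
    _ ≤ ∫⁻ x in Set.Ioo a b, (ENNReal.ofReal (d₁ x ^ 2 + d₂ x ^ 2 + d₃ x ^ 2) +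
          ENNReal.ofReal (α ^ 2) * ENNReal.ofReal (m₂ x ^ 2 + m₃ x ^ 2)) := by
        refine lintegral_mono_ae ((ae_restrict_iff' measurableSet_Ioo).2 ?_)
        filter_upwards [h₁.ae_hasDerivAt hle, h₂.ae_hasDerivAt hle, h₃.ae_hasDerivAt hle]
          with x hx₁ hx₂ hx₃ hx
        have hd := (hx₁ hx).inner_eq_zero_of_sphere (hx₂ hx) (hx₃ hx) <| by
          filter_upwards [Ioo_mem_nhds hx.1 hx.2] with y hy
          exact hsphere y (Set.Ioo_subset_Icc_self hy)
        rw [← ENNReal.ofReal_mul (by positivity), ← ENNReal.ofReal_mul (by positivity),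
          ← ENNReal.ofReal_add (by positivity) (by positivity)]
        exact ENNReal.ofReal_le_ofReal
          (two_mul_abs_le_of_tangent (hsphere x (Set.Ioo_subset_Icc_self hx)) hd)
    _ = _ := by
        rw [lintegral_add_right' _ (hmeas.const_mul _),
          lintegral_const_mul' _ _ ENNReal.ofReal_ne_top]
end

section
/- Let α > 0, β > 0 and θ ∈ ℝ, and define m^{α,β} : ℝ → ℝ³ by m^{α,β}(x) = ( (β e^{2√α x} − 1)/(β e^{2√α x} + 1), (2√β e^{√α x} cos θ)/(β e^{2√α x} + 1), (2√β e^{√α x} sin θ)/(β e^{2√α x} + 1) ). Then |m^{α,β}(x)| = 1 for all x, lim_{x→±∞} m^{α,β}(x) = (±1,0,0), and E_α(m^{α,β}) = ∫_ℝ |(m^{α,β})′|² + α ∫_ℝ ((m^{α,β}_2)² + (m^{α,β}_3)²) = 4√α. -/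
open MeasureTheory Filter

noncomputable section

/-- First component of the explicit wall profile `m^{α,β}`. -/
def w₁ (α β : ℝ) (x : ℝ) : ℝ :=
  (β * Real.exp (2 * Real.sqrt α * x) - 1) / (β * Real.exp (2 * Real.sqrt α * x) + 1)

/-- Second component of the explicit wall profile `m^{α,β}`. -/
def w₂ (α β θ : ℝ) (x : ℝ) : ℝ :=
  2 * Real.sqrt β * Real.exp (Real.sqrt α * x) * Real.cos θ /
    (β * Real.exp (2 * Real.sqrt α * x) + 1)

/-- Third component of the explicit wall profile `m^{α,β}`. -/
def w₃ (α β θ : ℝ) (x : ℝ) : ℝ :=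
  2 * Real.sqrt β * Real.exp (Real.sqrt α * x) * Real.sin θ /
    (β * Real.exp (2 * Real.sqrt α * x) + 1)

lemma wall_denom_pos {β : ℝ} (hβ : 0 < β) (y : ℝ) : 0 < β * Real.exp y + 1 := by positivity

lemma exp_two_sqrt_mul (α x : ℝ) :
    Real.exp (2 * Real.sqrt α * x) = Real.exp (Real.sqrt α * x) ^ 2 := by
  rw [← Real.exp_nat_mul]
  congr 1
  push_cast
  ring

lemma w₁_sq_add_w₂_sq_add_w₃_sq (α θ : ℝ) {β : ℝ} (hβ : 0 < β) (x : ℝ) :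
    w₁ α β x ^ 2 + w₂ α β θ x ^ 2 + w₃ α β θ x ^ 2 = 1 := by
  have hd := (wall_denom_pos hβ (2 * Real.sqrt α * x)).ne'
  simp only [w₁, w₂, w₃]
  rw [exp_two_sqrt_mul] at hd ⊢
  field_simp
  linear_combination (4 * Real.sqrt β ^ 2 * Real.exp (Real.sqrt α * x) ^ 2) *
    Real.cos_sq_add_sin_sq θ + 4 * Real.exp (Real.sqrt α * x) ^ 2 * Real.sq_sqrt hβ.le

lemma w₁_eq (α : ℝ) {β : ℝ} (hβ : 0 < β) (x : ℝ) :
    w₁ α β x = 1 - 2 / (β * Real.exp (2 * Real.sqrt α * x) + 1) := by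
  have hd := (wall_denom_pos hβ (2 * Real.sqrt α * x)).ne'
  simp only [w₁]
  field_simp
  ring

lemma hasDerivAt_exp_const_mul (c x : ℝ) :
    HasDerivAt (fun y => Real.exp (c * y)) (c * Real.exp (c * x)) x := by
  simpa [mul_comm] using ((hasDerivAt_id x).const_mul c).exp

lemma hasDerivAt_wall_denom (α β x : ℝ) :
    HasDerivAt (fun y => β * Real.exp (2 * Real.sqrt α * y) + 1)
      (β * (2 * Real.sqrt α * Real.exp (2 * Real.sqrt α * x))) x :=
  ((hasDerivAt_exp_const_mul _ x).const_mul β).add_const 1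

/-- The transverse components satisfy the gradient-flow equation `f' = -√α w₁ f`. -/
lemma hasDerivAt_wall_transverse (α c : ℝ) {β : ℝ} (hβ : 0 < β) (x : ℝ) :
    HasDerivAt (fun y => 2 * Real.sqrt β * Real.exp (Real.sqrt α * y) * c /
        (β * Real.exp (2 * Real.sqrt α * y) + 1))
      (-(Real.sqrt α * w₁ α β x * (2 * Real.sqrt β * Real.exp (Real.sqrt α * x) * c /
        (β * Real.exp (2 * Real.sqrt α * x) + 1)))) x := by
  have hd := (wall_denom_pos hβ (2 * Real.sqrt α * x)).ne'
  refine ((((hasDerivAt_exp_const_mul (Real.sqrt α) x).const_mul (2 * Real.sqrt β)).mul_const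
    c).div (hasDerivAt_wall_denom α β x) hd).congr_deriv ?_
  simp only [w₁]
  field_simp
  ring

lemma hasDerivAt_w₂ (α θ : ℝ) {β : ℝ} (hβ : 0 < β) (x : ℝ) :
    HasDerivAt (w₂ α β θ) (-(Real.sqrt α * w₁ α β x * w₂ α β θ x)) x :=
  hasDerivAt_wall_transverse α (Real.cos θ) hβ x

lemma hasDerivAt_w₃ (α θ : ℝ) {β : ℝ} (hβ : 0 < β) (x : ℝ) :
    HasDerivAt (w₃ α β θ) (-(Real.sqrt α * w₁ α β x * w₃ α β θ x)) x :=
  hasDerivAt_wall_transverse α (Real.sin θ) hβ x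

lemma hasDerivAt_w₁ (α θ : ℝ) {β : ℝ} (hβ : 0 < β) (x : ℝ) :
    HasDerivAt (w₁ α β) (Real.sqrt α * (w₂ α β θ x ^ 2 + w₃ α β θ x ^ 2)) x := by
  have hd := (wall_denom_pos hβ (2 * Real.sqrt α * x)).ne'
  have hq : w₂ α β θ x ^ 2 + w₃ α β θ x ^ 2 = 1 - w₁ α β x ^ 2 := by
    linear_combination w₁_sq_add_w₂_sq_add_w₃_sq α θ hβ x
  rw [hq]
  refine ((((hasDerivAt_exp_const_mul (2 * Real.sqrt α) x).const_mul β).sub_const 1).div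
    (hasDerivAt_wall_denom α β x) hd).congr_deriv ?_
  simp only [w₁]
  field_simp
  ring

lemma tendsto_w₁_atTop {α β : ℝ} (hα : 0 < α) (hβ : 0 < β) :
    Tendsto (w₁ α β) atTop (nhds 1) := by
  have hs : 0 < 2 * Real.sqrt α := by positivity
  have h : Tendsto (fun x => β * Real.exp (2 * Real.sqrt α * x) + 1) atTop atTop :=
    tendsto_atTop_add_const_right _ _
      ((Real.tendsto_exp_atTop.comp (tendsto_id.const_mul_atTop hs)).const_mul_atTop hβ)
  rw [funext (w₁_eq α hβ)]
  simpa using (h.const_div_atTop 2).const_sub 1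

lemma tendsto_w₁_atBot {α : ℝ} (β : ℝ) (hα : 0 < α) :
    Tendsto (w₁ α β) atBot (nhds (-1)) := by
  have hs : 0 < 2 * Real.sqrt α := by positivity
  have h : Tendsto (fun x => β * Real.exp (2 * Real.sqrt α * x)) atBot (nhds 0) := by
    simpa using
      (Real.tendsto_exp_atBot.comp (tendsto_id.const_mul_atBot hs)).const_mul β
  have := (h.sub_const 1).div (h.add_const 1) (by norm_num)
  norm_num at this
  exact this

/-- A sphere-valued profile whose first component tends to a pole tends to that pole. -/
lemma tendsto_pole_of_tendsto_fst {f g h : ℝ → ℝ} {l : Filter ℝ} {a : ℝ}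
    (hsphere : ∀ x, f x ^ 2 + g x ^ 2 + h x ^ 2 = 1) (ha : a ^ 2 = 1)
    (hf : Tendsto f l (nhds a)) :
    Tendsto (fun x => (f x, g x, h x)) l (nhds (a, 0, 0)) := by
  have hlim : Tendsto (fun x => Real.sqrt (1 - f x ^ 2)) l (nhds 0) := by
    simpa [ha] using ((hf.pow 2).const_sub 1).sqrt
  refine hf.prodMk_nhds (Tendsto.prodMk_nhds ?_ ?_)
  · refine squeeze_zero_norm (fun x => Real.abs_le_sqrt ?_) hlim
    nlinarith [hsphere x, sq_nonneg (h x)]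
  · refine squeeze_zero_norm (fun x => Real.abs_le_sqrt ?_) hlim
    nlinarith [hsphere x, sq_nonneg (g x)]

/-- A nonnegative derivative of a function with finite limits at `±∞` is integrable. -/
lemma integrable_of_hasDerivAt_of_nonneg {f f' : ℝ → ℝ} {a b : ℝ}
    (hderiv : ∀ x, HasDerivAt f (f' x) x) (hnonneg : ∀ x, 0 ≤ f' x)
    (hbot : Tendsto f atBot (nhds a)) (htop : Tendsto f atTop (nhds b)) : Integrable f' := by
  have hneg : IntegrableOn (f' ∘ Neg.neg) (Set.Ioi 0) := by
    refine integrableOn_Ioi_deriv_of_nonneg' (g := fun x => -f (-x)) (fun x _ => ?_)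
      (fun x _ => hnonneg (-x)) (hbot.comp tendsto_neg_atTop_atBot).neg
    exact ((hderiv (-x)).comp x (hasDerivAt_neg x)).neg.congr_deriv (by simp)
  have hleft : IntegrableOn f' (Set.Iio 0) := by
    rw [← (Measure.measurePreserving_neg volume).integrableOn_comp_preimage
      (Homeomorph.neg ℝ).measurableEmbedding]
    simpa using hneg
  rw [← integrableOn_univ, ← Set.Iic_union_Ioi (a := (0 : ℝ))]
  exact ((integrableOn_Iic_iff_integrableOn_Iio (by simp)).2 hleft).union
    (integrableOn_Ioi_deriv_of_nonneg' (fun x _ => hderiv x) (fun x _ => hnonneg x) htop)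

lemma integral_w₂_sq_add_w₃_sq {α β : ℝ} (θ : ℝ) (hα : 0 < α) (hβ : 0 < β) :
    Real.sqrt α * ∫ x : ℝ, (w₂ α β θ x ^ 2 + w₃ α β θ x ^ 2) = 2 := by
  have hderiv := hasDerivAt_w₁ α θ hβ
  have hnonneg (x : ℝ) : 0 ≤ Real.sqrt α * (w₂ α β θ x ^ 2 + w₃ α β θ x ^ 2) := by positivity
  have hint : Integrable fun x => Real.sqrt α * (w₂ α β θ x ^ 2 + w₃ α β θ x ^ 2) :=
    integrable_of_hasDerivAt_of_nonneg hderiv hnonneg (tendsto_w₁_atBot β hα)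
      (tendsto_w₁_atTop hα hβ)
  rw [← integral_const_mul, integral_of_hasDerivAt_of_tendsto hderiv hint
    (tendsto_w₁_atBot β hα) (tendsto_w₁_atTop hα hβ)]
  norm_num

/-- Equipartition: the exchange density equals the anisotropy density. -/
lemma deriv_sq_add_deriv_sq_add_deriv_sq {α β : ℝ} (θ : ℝ) (hα : 0 < α) (hβ : 0 < β) (x : ℝ) :
    deriv (w₁ α β) x ^ 2 + deriv (w₂ α β θ) x ^ 2 + deriv (w₃ α β θ) x ^ 2 =
      α * (w₂ α β θ x ^ 2 + w₃ α β θ x ^ 2) := by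
  rw [(hasDerivAt_w₁ α θ hβ x).deriv, (hasDerivAt_w₂ α θ hβ x).deriv,
    (hasDerivAt_w₃ α θ hβ x).deriv]
  linear_combination (w₂ α β θ x ^ 2 + w₃ α β θ x ^ 2) * Real.sq_sqrt hα.le +
    Real.sqrt α ^ 2 * (w₂ α β θ x ^ 2 + w₃ α β θ x ^ 2) *
      w₁_sq_add_w₂_sq_add_w₃_sq α θ hβ x

/-- for `α, β > 0` and `θ ∈ ℝ`, the explicit profile `m^{α,β}` is
S²-valued, satisfies `m^{α,β}(x) → (±1,0,0)` as `x → ±∞`, and its wall energy is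
`E_α(m^{α,β}) = ∫_ℝ |(m^{α,β})′|² + α ∫_ℝ ((m₂^{α,β})² + (m₃^{α,β})²) = 4 √α`. -/
theorem statement14 (α β θ : ℝ) (hα : 0 < α) (hβ : 0 < β) :
    (∀ x, w₁ α β x ^ 2 + w₂ α β θ x ^ 2 + w₃ α β θ x ^ 2 = 1) ∧
    Tendsto (fun x => (w₁ α β x, w₂ α β θ x, w₃ α β θ x)) atTop (nhds (1, 0, 0)) ∧
    Tendsto (fun x => (w₁ α β x, w₂ α β θ x, w₃ α β θ x)) atBot (nhds (-1, 0, 0)) ∧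
    (∫ x : ℝ, ((deriv (w₁ α β) x) ^ 2 + (deriv (w₂ α β θ) x) ^ 2
        + (deriv (w₃ α β θ) x) ^ 2)) +
      α * ∫ x : ℝ, (w₂ α β θ x ^ 2 + w₃ α β θ x ^ 2) = 4 * Real.sqrt α := by
  refine ⟨w₁_sq_add_w₂_sq_add_w₃_sq α θ hβ,
    tendsto_pole_of_tendsto_fst (w₁_sq_add_w₂_sq_add_w₃_sq α θ hβ) (one_pow 2)
      (tendsto_w₁_atTop hα hβ),
    tendsto_pole_of_tendsto_fst (w₁_sq_add_w₂_sq_add_w₃_sq α θ hβ) neg_one_sq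
      (tendsto_w₁_atBot β hα), ?_⟩
  simp_rw [deriv_sq_add_deriv_sq_add_deriv_sq θ hα hβ]
  rw [integral_const_mul]
  linear_combination 2 * Real.sqrt α * integral_w₂_sq_add_w₃_sq θ hα hβ -
    2 * (∫ x : ℝ, (w₂ α β θ x ^ 2 + w₃ α β θ x ^ 2)) * Real.sq_sqrt hα.le
end
end

section
/- Let A > 0 and 0 < α₂ < α₃. For every locally absolutely continuous m = (m₁,m₂,m₃) : ℝ → S² with lim_{x→±∞} m(x) = (±1,0,0), there holds E₀(m) = A ∫_ℝ |m′|² + α₂ ∫_ℝ m₂² + α₃ ∫_ℝ m₃² ≥ 4 √(α₂ A); moreover, setting α_ω = α₂/A, the map m^ω(x) = ( (e^{2√α_ω x} − 1)/(e^{2√α_ω x} + 1), 2 e^{√α_ω x}/(e^{2√α_ω x} + 1), 0 ) is admissible and satisfies E₀(m^ω) = 4 √(α₂ A), so the minimum of E₀ over this class equals 4 √(α₂ A). -/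
open MeasureTheory Filter

noncomputable section

/-- `f` is locally absolutely continuous on ℝ with a.e. derivative `f'`:
`f'` is locally integrable and `f(b) − f(a) = ∫_a^b f'` for all `a, b`. -/
def LocAC (f f' : ℝ → ℝ) : Prop :=
  (∀ a b : ℝ, IntervalIntegrable f' volume a b) ∧
  ∀ a b : ℝ, f b - f a = ∫ x in a..b, f' x

/-- Membership in the admissible class `A₀`: `m = (m₁,m₂,m₃)` is locally absolutely
continuous (with a.e. derivative `(d₁,d₂,d₃)`), S²-valued, and `m(x) → (±1,0,0)` as
`x → ±∞`. -/
def Adm0 (m₁ m₂ m₃ d₁ d₂ d₃ : ℝ → ℝ) : Prop :=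
  LocAC m₁ d₁ ∧ LocAC m₂ d₂ ∧ LocAC m₃ d₃ ∧
  (∀ x, m₁ x ^ 2 + m₂ x ^ 2 + m₃ x ^ 2 = 1) ∧
  Tendsto (fun x => (m₁ x, m₂ x, m₃ x)) atTop (nhds (1, 0, 0)) ∧
  Tendsto (fun x => (m₁ x, m₂ x, m₃ x)) atBot (nhds (-1, 0, 0))

/-- The reduced wall energy `E₀(m) = A ∫ |m′|² + α₂ ∫ m₂² + α₃ ∫ m₃²` (valued in
`ℝ≥0∞`, since it may be infinite). -/
def E0 (A α₂ α₃ : ℝ) (m₂ m₃ d₁ d₂ d₃ : ℝ → ℝ) : ENNReal :=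
  ENNReal.ofReal A * (∫⁻ x : ℝ, ENNReal.ofReal (d₁ x ^ 2 + d₂ x ^ 2 + d₃ x ^ 2)) +
    ENNReal.ofReal α₂ * (∫⁻ x : ℝ, ENNReal.ofReal (m₂ x ^ 2)) +
    ENNReal.ofReal α₃ * (∫⁻ x : ℝ, ENNReal.ofReal (m₃ x ^ 2))

/-- First component of the optimal profile `m^ω`. -/
def mw₁ (aw : ℝ) (x : ℝ) : ℝ :=
  (Real.exp (2 * Real.sqrt aw * x) - 1) / (Real.exp (2 * Real.sqrt aw * x) + 1)

/-- Second component of the optimal profile `m^ω`. -/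
def mw₂ (aw : ℝ) (x : ℝ) : ℝ :=
  2 * Real.exp (Real.sqrt aw * x) / (Real.exp (2 * Real.sqrt aw * x) + 1)

theorem LocAC.ae_hasDerivAt {f f' : ℝ → ℝ} (h : LocAC f f') :
    ∀ᵐ x, HasDerivAt f (f' x) x := by
  have hloc : LocallyIntegrable f' volume := fun x =>
    ⟨Set.Ioc (x - 1) (x + 1), Ioc_mem_nhds (by linarith) (by linarith), (h.1 _ _).1⟩
  filter_upwards [LocallyIntegrable.ae_hasDerivAt_integral hloc] with x hx
  have hf : f = fun y => f 0 + ∫ t in (0 : ℝ)..y, f' t := by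
    funext y
    rw [← h.2 0 y]
    ring
  rw [hf]
  exact (hx 0).const_add (f 0)

theorem LocAC.continuous {f f' : ℝ → ℝ} (h : LocAC f f') : Continuous f := by
  have hf : f = fun y => f 0 + ∫ t in (0 : ℝ)..y, f' t := by
    funext y
    rw [← h.2 0 y]
    ring
  rw [hf]
  exact continuous_const.add (intervalIntegral.continuous_primitive h.1 0)

theorem LocAC.of_hasDerivAt {f f' : ℝ → ℝ} (h : ∀ x, HasDerivAt f (f' x) x)
    (hc : Continuous f') : LocAC f f' :=
  ⟨fun a b => hc.intervalIntegrable a b, fun a b =>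
    (intervalIntegral.integral_eq_sub_of_hasDerivAt (fun x _ => h x)
      (hc.intervalIntegrable a b)).symm⟩

theorem LocAC.ofReal_sub_le_lintegral_abs {f f' : ℝ → ℝ} (h : LocAC f f') {a b : ℝ}
    (hab : a ≤ b) : ENNReal.ofReal (f b - f a) ≤ ∫⁻ x, ENNReal.ofReal |f' x| := by
  rw [h.2 a b, intervalIntegral.integral_of_le hab]
  calc ENNReal.ofReal (∫ x in Set.Ioc a b, f' x)
      ≤ ‖∫ x in Set.Ioc a b, f' x‖ₑ := by
        rw [Real.enorm_eq_ofReal_abs]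
        exact ENNReal.ofReal_le_ofReal (le_abs_self _)
    _ ≤ ∫⁻ x in Set.Ioc a b, ‖f' x‖ₑ := enorm_integral_le_lintegral_enorm _
    _ ≤ ∫⁻ x, ‖f' x‖ₑ := setLIntegral_le_lintegral _ _
    _ = ∫⁻ x, ENNReal.ofReal |f' x| := by simp_rw [Real.enorm_eq_ofReal_abs]

/-- The total variation of a locally absolutely continuous function bounds the difference
of its limits at `±∞`. -/
theorem LocAC.ofReal_sub_le_lintegral_abs_of_tendsto {f f' : ℝ → ℝ} (h : LocAC f f')
    {p q : ℝ} (hp : Tendsto f atBot (nhds p)) (hq : Tendsto f atTop (nhds q)) :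
    ENNReal.ofReal (q - p) ≤ ∫⁻ x, ENNReal.ofReal |f' x| := by
  have hlim : Tendsto (fun x : ℝ => ENNReal.ofReal (f x - f (-x))) atTop
      (nhds (ENNReal.ofReal (q - p))) :=
    ENNReal.tendsto_ofReal (hq.sub (hp.comp tendsto_neg_atTop_atBot))
  refine le_of_tendsto hlim ?_
  filter_upwards [eventually_ge_atTop (0 : ℝ)] with x hx
  exact h.ofReal_sub_le_lintegral_abs (by linarith)

/-- Along a curve on the sphere with velocity `d` tangent at `m`,
`√(α₂ A) |d₁|` is dominated by half the energy density. -/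
theorem two_mul_sqrt_mul_abs_le_energy_density {A α₂ α₃ m₁ m₂ m₃ d₁ d₂ d₃ : ℝ} (hA : 0 ≤ A)
    (h₂ : 0 ≤ α₂) (h₂₃ : α₂ ≤ α₃) (hm : m₁ ^ 2 + m₂ ^ 2 + m₃ ^ 2 = 1)
    (hd : m₁ * d₁ + m₂ * d₂ + m₃ * d₃ = 0) :
    2 * √(α₂ * A) * |d₁| ≤
      A * (d₁ ^ 2 + d₂ ^ 2 + d₃ ^ 2) + α₂ * m₂ ^ 2 + α₃ * m₃ ^ 2 := by
  set N := d₁ ^ 2 + d₂ ^ 2 + d₃ ^ 2 with hN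
  set P := m₂ ^ 2 + m₃ ^ 2 with hP
  have hN0 : 0 ≤ N := by positivity
  have hP0 : 0 ≤ P := by positivity
  have hcs : d₁ ^ 2 ≤ P * N := by
    have h1 : (m₁ * d₁) ^ 2 = (m₂ * d₂ + m₃ * d₃) ^ 2 := by
      rw [show m₁ * d₁ = -(m₂ * d₂ + m₃ * d₃) by linarith]
      ring
    have h2 : d₁ ^ 2 = (m₁ * d₁) ^ 2 + P * d₁ ^ 2 := by
      rw [hP]
      linear_combination (-d₁ ^ 2) * hm
    rw [h2, h1, hN, hP]
    nlinarith [sq_nonneg (m₂ * d₃ - m₃ * d₂)]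
  have hle : 2 * √(α₂ * A) * |d₁| ≤ A * N + α₂ * P := by
    refine abs_le_of_sq_le_sq' ?_ (by positivity) |>.2
    rw [mul_pow, mul_pow, sq_abs, Real.sq_sqrt (by positivity)]
    nlinarith [mul_le_mul_of_nonneg_left hcs (mul_nonneg h₂ hA), sq_nonneg (A * N - α₂ * P)]
  have hP3 : α₂ * m₃ ^ 2 ≤ α₃ * m₃ ^ 2 := by gcongr
  rw [hP] at hle
  linarith

theorem Adm0.energy_density_ae {A α₂ α₃ : ℝ} (hA : 0 ≤ A) (h₂ : 0 ≤ α₂) (h₂₃ : α₂ ≤ α₃)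
    {m₁ m₂ m₃ d₁ d₂ d₃ : ℝ → ℝ} (h : Adm0 m₁ m₂ m₃ d₁ d₂ d₃) :
    ∀ᵐ x, 2 * √(α₂ * A) * |d₁ x| ≤
      A * (d₁ x ^ 2 + d₂ x ^ 2 + d₃ x ^ 2) + α₂ * m₂ x ^ 2 + α₃ * m₃ x ^ 2 := by
  obtain ⟨h1, h2, h3, hm, -⟩ := h
  filter_upwards [h1.ae_hasDerivAt, h2.ae_hasDerivAt, h3.ae_hasDerivAt] with x hx1 hx2 hx3
  refine two_mul_sqrt_mul_abs_le_energy_density hA h₂ h₂₃ (hm x) ?_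
  have hsq := ((hx1.pow 2).add (hx2.pow 2)).add (hx3.pow 2)
  have hone : m₁ ^ 2 + m₂ ^ 2 + m₃ ^ 2 = fun _ => 1 := funext hm
  rw [hone] at hsq
  have := hsq.unique (hasDerivAt_const x 1)
  norm_num at this
  linarith

theorem E0_eq_lintegral {A α₂ α₃ : ℝ} (hA : 0 ≤ A) (h₂ : 0 ≤ α₂) (h₃ : 0 ≤ α₃)
    {m₂ m₃ : ℝ → ℝ} (d₁ d₂ d₃ : ℝ → ℝ) (hm₂ : Continuous m₂) (hm₃ : Continuous m₃) :
    E0 A α₂ α₃ m₂ m₃ d₁ d₂ d₃ = ∫⁻ x, ENNReal.ofReal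
      (A * (d₁ x ^ 2 + d₂ x ^ 2 + d₃ x ^ 2) + α₂ * m₂ x ^ 2 + α₃ * m₃ x ^ 2) := by
  rw [E0, ← lintegral_const_mul' _ _ ENNReal.ofReal_ne_top,
    ← lintegral_const_mul' _ _ ENNReal.ofReal_ne_top,
    ← lintegral_const_mul' _ _ ENNReal.ofReal_ne_top,
    ← lintegral_add_right _ (by fun_prop), ← lintegral_add_right _ (by fun_prop)]
  congr 1
  funext x
  rw [← ENNReal.ofReal_mul hA, ← ENNReal.ofReal_mul h₂, ← ENNReal.ofReal_mul h₃,
    ← ENNReal.ofReal_add (by positivity) (by positivity),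
    ← ENNReal.ofReal_add (by positivity) (by positivity)]

theorem Adm0.le_E0 {A α₂ α₃ : ℝ} (hA : 0 ≤ A) (h₂ : 0 ≤ α₂) (h₂₃ : α₂ ≤ α₃)
    {m₁ m₂ m₃ d₁ d₂ d₃ : ℝ → ℝ} (h : Adm0 m₁ m₂ m₃ d₁ d₂ d₃) :
    ENNReal.ofReal (4 * √(α₂ * A)) ≤ E0 A α₂ α₃ m₂ m₃ d₁ d₂ d₃ := by
  have hae := h.energy_density_ae hA h₂ h₂₃
  obtain ⟨h1, h2, h3, -, htop, hbot⟩ := h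
  have hvar := h1.ofReal_sub_le_lintegral_abs_of_tendsto
    ((continuous_fst.tendsto _).comp hbot) ((continuous_fst.tendsto _).comp htop)
  rw [E0_eq_lintegral hA h₂ (h₂.trans h₂₃) _ _ _ h2.continuous h3.continuous]
  calc ENNReal.ofReal (4 * √(α₂ * A))
      = ENNReal.ofReal (2 * √(α₂ * A)) * ENNReal.ofReal (1 - -1) := by
        rw [← ENNReal.ofReal_mul (by positivity)]
        congr 1
        ring
    _ ≤ ENNReal.ofReal (2 * √(α₂ * A)) * ∫⁻ x, ENNReal.ofReal |d₁ x| := by gcongr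
    _ = ∫⁻ x, ENNReal.ofReal (2 * √(α₂ * A) * |d₁ x|) := by
        rw [← lintegral_const_mul' _ _ ENNReal.ofReal_ne_top]
        simp_rw [ENNReal.ofReal_mul (show 0 ≤ 2 * √(α₂ * A) by positivity)]
    _ ≤ _ := lintegral_mono_ae (hae.mono fun x hx => ENNReal.ofReal_le_ofReal hx)

theorem exp_two_mul_sqrt_mul (aw x : ℝ) :
    Real.exp (2 * √aw * x) = Real.exp (√aw * x) ^ 2 := by
  rw [← Real.exp_nat_mul]
  congr 1
  push_cast
  ring

theorem mw₁_sq_add_mw₂_sq (aw x : ℝ) : mw₁ aw x ^ 2 + mw₂ aw x ^ 2 = 1 := by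
  rw [mw₁, mw₂, exp_two_mul_sqrt_mul]
  field_simp
  ring

theorem hasDerivAt_mw₁ (aw x : ℝ) : HasDerivAt (mw₁ aw) (√aw * mw₂ aw x ^ 2) x := by
  have he : HasDerivAt (fun y => Real.exp (2 * √aw * y))
      (Real.exp (2 * √aw * x) * (2 * √aw)) x := by
    simpa using ((hasDerivAt_id x).const_mul (2 * √aw)).exp
  refine ((he.sub_const 1).div (he.add_const 1) (by positivity)).congr_deriv ?_
  rw [mw₂, exp_two_mul_sqrt_mul]
  field_simp
  ring

theorem hasDerivAt_mw₂ (aw x : ℝ) :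
    HasDerivAt (mw₂ aw) (-(√aw * mw₁ aw x * mw₂ aw x)) x := by
  have he : HasDerivAt (fun y => Real.exp (2 * √aw * y))
      (Real.exp (2 * √aw * x) * (2 * √aw)) x := by
    simpa using ((hasDerivAt_id x).const_mul (2 * √aw)).exp
  have hs : HasDerivAt (fun y => Real.exp (√aw * y)) (Real.exp (√aw * x) * √aw) x := by
    simpa using ((hasDerivAt_id x).const_mul (√aw)).exp
  refine ((hs.const_mul 2).div (he.add_const 1) (by positivity)).congr_deriv ?_
  rw [mw₁, mw₂, exp_two_mul_sqrt_mul]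
  field_simp
  ring

theorem continuous_mw₁ (aw : ℝ) : Continuous (mw₁ aw) :=
  continuous_iff_continuousAt.2 fun x => (hasDerivAt_mw₁ aw x).continuousAt

theorem continuous_mw₂ (aw : ℝ) : Continuous (mw₂ aw) :=
  continuous_iff_continuousAt.2 fun x => (hasDerivAt_mw₂ aw x).continuousAt

theorem mw₂_eq_sqrt (aw x : ℝ) : mw₂ aw x = √(1 - mw₁ aw x ^ 2) := by
  rw [← mw₁_sq_add_mw₂_sq aw x, add_sub_cancel_left, Real.sqrt_sq]
  rw [mw₂]
  positivity

theorem tendsto_mw₁_atTop {aw : ℝ} (h : 0 < aw) : Tendsto (mw₁ aw) atTop (nhds 1) := by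
  have hs : 0 < 2 * √aw := by positivity
  have he : Tendsto (fun x => Real.exp (2 * √aw * x) + 1) atTop atTop :=
    tendsto_atTop_add_const_right _ _
      (Real.tendsto_exp_atTop.comp (tendsto_id.const_mul_atTop hs))
  have hlim : Tendsto (fun x => 1 - 2 * (Real.exp (2 * √aw * x) + 1)⁻¹) atTop
      (nhds (1 - 2 * 0)) := (he.inv_tendsto_atTop.const_mul 2).const_sub 1
  rw [mul_zero, sub_zero] at hlim
  refine hlim.congr fun x => ?_
  rw [mw₁]
  field_simp
  ring

theorem tendsto_mw₁_atBot {aw : ℝ} (h : 0 < aw) : Tendsto (mw₁ aw) atBot (nhds (-1)) := by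
  have hs : 0 < 2 * √aw := by positivity
  have he : Tendsto (fun x => Real.exp (2 * √aw * x)) atBot (nhds 0) :=
    Real.tendsto_exp_atBot.comp (tendsto_id.const_mul_atBot hs)
  have hlim := (he.sub_const 1).div (he.add_const 1) (by norm_num)
  norm_num at hlim
  exact hlim

theorem tendsto_mw₂ {aw ε : ℝ} {l : Filter ℝ} (hε : ε ^ 2 = 1)
    (h : Tendsto (mw₁ aw) l (nhds ε)) : Tendsto (mw₂ aw) l (nhds 0) := by
  have hlim := ((h.pow 2).const_sub 1).sqrt
  rw [hε, sub_self, Real.sqrt_zero] at hlim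
  exact hlim.congr fun x => (mw₂_eq_sqrt aw x).symm

theorem adm0_mw {aw : ℝ} (h : 0 < aw) :
    Adm0 (mw₁ aw) (mw₂ aw) (fun _ => 0) (fun x => √aw * mw₂ aw x ^ 2)
      (fun x => -(√aw * mw₁ aw x * mw₂ aw x)) (fun _ => 0) := by
  have hc₁ := continuous_mw₁ aw
  have hc₂ := continuous_mw₂ aw
  refine ⟨.of_hasDerivAt (hasDerivAt_mw₁ aw) (by fun_prop),
    .of_hasDerivAt (hasDerivAt_mw₂ aw) (by fun_prop),
    .of_hasDerivAt (fun x => hasDerivAt_const x 0) continuous_const, fun x => ?_, ?_, ?_⟩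
  · rw [← mw₁_sq_add_mw₂_sq aw x]
    ring
  · exact (tendsto_mw₁_atTop h).prodMk_nhds
      ((tendsto_mw₂ (one_pow 2) (tendsto_mw₁_atTop h)).prodMk_nhds tendsto_const_nhds)
  · exact (tendsto_mw₁_atBot h).prodMk_nhds
      ((tendsto_mw₂ (by norm_num) (tendsto_mw₁_atBot h)).prodMk_nhds tendsto_const_nhds)

theorem lintegral_deriv_mw₁ {aw : ℝ} (h : 0 < aw) :
    ∫⁻ x, ENNReal.ofReal (√aw * mw₂ aw x ^ 2) = ENNReal.ofReal 2 := by
  have hc₂ := continuous_mw₂ aw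
  have hc : Continuous fun x => √aw * mw₂ aw x ^ 2 := by fun_prop
  have hnn : ∀ x, 0 ≤ √aw * mw₂ aw x ^ 2 := fun x => by positivity
  have hle : ∀ x, |mw₁ aw x| ≤ 1 := fun x => by
    rw [← sq_le_one_iff_abs_le_one]
    nlinarith [mw₁_sq_add_mw₂_sq aw x, sq_nonneg (mw₂ aw x)]
  have hint : Integrable fun x => √aw * mw₂ aw x ^ 2 := by
    refine integrable_of_intervalIntegral_norm_bounded (l := atTop) (a := fun x : ℝ => -x)
      (b := id) 2 (fun x => hc.integrableOn_Ioc) tendsto_neg_atTop_atBot tendsto_id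
      (Eventually.of_forall fun x => ?_)
    simp_rw [Real.norm_of_nonneg (hnn _)]
    rw [intervalIntegral.integral_eq_sub_of_hasDerivAt (fun y _ => hasDerivAt_mw₁ aw y)
      (hc.intervalIntegrable _ _)]
    linarith [(abs_le.1 (hle (id x))).2, (abs_le.1 (hle (-x))).1]
  rw [← ofReal_integral_eq_lintegral_ofReal hint (Eventually.of_forall hnn),
    integral_of_hasDerivAt_of_tendsto (hasDerivAt_mw₁ aw) hint (tendsto_mw₁_atBot h)
      (tendsto_mw₁_atTop h)]
  norm_num

theorem E0_mw {A α₂ α₃ : ℝ} (hA : 0 < A) (h₂ : 0 < α₂) (h₃ : 0 ≤ α₃) :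
    E0 A α₂ α₃ (mw₂ (α₂ / A)) (fun _ => 0) (fun x => √(α₂ / A) * mw₂ (α₂ / A) x ^ 2)
      (fun x => -(√(α₂ / A) * mw₁ (α₂ / A) x * mw₂ (α₂ / A) x)) (fun _ => 0) =
      ENNReal.ofReal (4 * √(α₂ * A)) := by
  have haw : 0 < α₂ / A := by positivity
  have hsq : √(α₂ / A) ^ 2 = α₂ / A := Real.sq_sqrt haw.le
  have hsqrt : √(α₂ * A) = A * √(α₂ / A) := by
    rw [show α₂ * A = A ^ 2 * (α₂ / A) by field_simp, Real.sqrt_mul (sq_nonneg A),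
      Real.sqrt_sq hA.le]
  have hdens : A * √(α₂ / A) ^ 2 = α₂ := by
    rw [hsq]
    field_simp
  have hnn : 0 ≤ 2 * √(α₂ * A) := by positivity
  rw [E0_eq_lintegral hA.le h₂.le h₃ _ _ _ (continuous_mw₂ _) continuous_const]
  calc _ = ∫⁻ x, ENNReal.ofReal (2 * √(α₂ * A)) *
        ENNReal.ofReal (√(α₂ / A) * mw₂ (α₂ / A) x ^ 2) := by
        congr 1
        funext x
        rw [← ENNReal.ofReal_mul hnn, hsqrt]
        congr 1
        linear_combination A * √(α₂ / A) ^ 2 * mw₂ (α₂ / A) x ^ 2 *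
          mw₁_sq_add_mw₂_sq (α₂ / A) x - mw₂ (α₂ / A) x ^ 2 * hdens
    _ = _ := by
        rw [lintegral_const_mul' _ _ ENNReal.ofReal_ne_top, lintegral_deriv_mw₁ haw,
          ← ENNReal.ofReal_mul hnn]
        congr 1
        ring

/-- for `A > 0` and `0 < α₂ < α₃`, every admissible `m ∈ A₀` satisfies
`E₀(m) ≥ 4 √(α₂ A)`; moreover, with `α_ω = α₂/A`, the profile
`m^ω = (mw₁, mw₂, 0)` is admissible with `E₀(m^ω) = 4 √(α₂ A)`, so the minimum of `E₀`
over `A₀` equals `4 √(α₂ A)`. -/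
theorem statement15 (A α₂ α₃ : ℝ) (hA : 0 < A) (h₂ : 0 < α₂) (h₂₃ : α₂ < α₃) :
    (∀ m₁ m₂ m₃ d₁ d₂ d₃ : ℝ → ℝ, Adm0 m₁ m₂ m₃ d₁ d₂ d₃ →
      ENNReal.ofReal (4 * Real.sqrt (α₂ * A)) ≤ E0 A α₂ α₃ m₂ m₃ d₁ d₂ d₃) ∧
    (∃ d₁ d₂ d₃ : ℝ → ℝ,
      Adm0 (mw₁ (α₂ / A)) (mw₂ (α₂ / A)) (fun _ => 0) d₁ d₂ d₃ ∧
      E0 A α₂ α₃ (mw₂ (α₂ / A)) (fun _ => 0) d₁ d₂ d₃ =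
        ENNReal.ofReal (4 * Real.sqrt (α₂ * A))) ∧
    sInf {e : ENNReal | ∃ m₁ m₂ m₃ d₁ d₂ d₃ : ℝ → ℝ,
        Adm0 m₁ m₂ m₃ d₁ d₂ d₃ ∧ e = E0 A α₂ α₃ m₂ m₃ d₁ d₂ d₃} =
      ENNReal.ofReal (4 * Real.sqrt (α₂ * A)) := by
  have hlow : ∀ m₁ m₂ m₃ d₁ d₂ d₃ : ℝ → ℝ, Adm0 m₁ m₂ m₃ d₁ d₂ d₃ →
      ENNReal.ofReal (4 * Real.sqrt (α₂ * A)) ≤ E0 A α₂ α₃ m₂ m₃ d₁ d₂ d₃ :=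
    fun _ _ _ _ _ _ h => h.le_E0 hA.le h₂.le h₂₃.le
  have hadm := adm0_mw (div_pos h₂ hA)
  have hE := E0_mw hA h₂ (h₂.trans h₂₃).le
  refine ⟨hlow, ⟨_, _, _, hadm, hE⟩, le_antisymm ?_ ?_⟩
  · exact sInf_le ⟨_, _, _, _, _, _, hadm, hE.symm⟩
  · refine le_sInf ?_
    rintro e ⟨m₁, m₂, m₃, d₁, d₂, d₃, h, rfl⟩
    exact hlow _ _ _ _ _ _ h
end
end
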